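/- For every σ > 0 there exists a constant C > 0 such that for every n ∈ ℤ and every ξ ∈ ℝ, Σ_{(n₁,n₂)∈ℤ²} ⟨n₁⟩^{−2σ} · ⟨n₂⟩^{−2σ} · ⟨n − n₁ − n₂⟩^{−2σ} · ⟨ξ + n₁² + n₂² + (n − n₁ − n₂)²⟩^{−1−2σ} ≤ C. -/

import Mathlib

open scoped ENNReal

/-- The Japanese bracket `⟨x⟩ = (1 + x²)^(1/2)`. -/
noncomputable def jb (x : ℝ) : ℝ := Real.sqrt (1 + x ^ 2)

/-- The divisor bound `d(n) = O(n ^ ε)`. -/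
theorem exists_card_divisors_le_rpow {ε : ℝ} (hε : 0 < ε) :
    ∃ C : ℝ, 0 < C ∧ ∀ n : ℕ, n ≠ 0 → (n.divisors.card : ℝ) ≤ C * (n : ℝ) ^ ε := by
  set B : ℝ := max 1 (1 / (ε * Real.log 2)) with hB
  have hB1 : 1 ≤ B := le_max_left _ _
  have hlog : 0 < ε * Real.log 2 := mul_pos hε (Real.log_pos one_lt_two)
  have hB2 : 1 ≤ B * (ε * Real.log 2) := by
    rw [← div_le_iff₀ hlog]; exact le_max_right _ _
  set P : ℕ := ⌈(2 : ℝ) ^ (1 / ε)⌉₊ with hP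
  have key : ∀ p a : ℕ, p.Prime →
      ((a + 1 : ℕ) : ℝ) ≤ (if p < P then B else 1) * (((p ^ a : ℕ) : ℝ) ^ ε) := by
    intro p a hp
    have hp2 : (2 : ℝ) ≤ p := by exact_mod_cast hp.two_le
    have hpow : ((p ^ a : ℕ) : ℝ) ^ ε = ((p : ℝ) ^ ε) ^ a := by
      push_cast
      rw [← Real.rpow_natCast, ← Real.rpow_natCast, ← Real.rpow_mul (by positivity),
        ← Real.rpow_mul (by positivity), mul_comm]
    rw [hpow]
    split_ifs with h
    · have h1 : (1 : ℝ) + a * (ε * Real.log 2) ≤ ((p : ℝ) ^ ε) ^ a := by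
        have h2 : ((2 : ℝ) ^ ε) ^ a ≤ ((p : ℝ) ^ ε) ^ a := by gcongr
        refine le_trans ?_ h2
        rw [Real.rpow_def_of_pos two_pos, ← Real.exp_nat_mul]
        have := Real.add_one_le_exp ((a : ℝ) * (Real.log 2 * ε))
        linarith
      have h3 : B * (1 + a * (ε * Real.log 2)) ≤ B * ((p : ℝ) ^ ε) ^ a := by gcongr
      have h4 : (a : ℝ) * 1 ≤ a * (B * (ε * Real.log 2)) := by gcongr
      push_cast
      linarith
    · have h1 : (2 : ℝ) ^ (1 / ε) ≤ p := (Nat.le_ceil _).trans (by exact_mod_cast not_lt.1 h)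
      have h2 : (2 : ℝ) ≤ (p : ℝ) ^ ε := by
        calc (2 : ℝ) = ((2 : ℝ) ^ (1 / ε)) ^ ε := by
              rw [← Real.rpow_mul two_pos.le, one_div_mul_cancel hε.ne', Real.rpow_one]
          _ ≤ _ := by gcongr
      have h3 : (2 : ℝ) ^ a ≤ ((p : ℝ) ^ ε) ^ a := by gcongr
      have h4 : ((a + 1 : ℕ) : ℝ) ≤ (2 : ℝ) ^ a := by exact_mod_cast Nat.lt_two_pow_self
      linarith
  refine ⟨B ^ P, by positivity, fun n hn => ?_⟩
  calc (n.divisors.card : ℝ)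
      = ∏ p ∈ n.primeFactors, ((n.factorization p + 1 : ℕ) : ℝ) := by
        rw [Nat.card_divisors hn]; push_cast; rfl
    _ ≤ ∏ p ∈ n.primeFactors,
          ((if p < P then B else 1) * (((p ^ n.factorization p : ℕ) : ℝ) ^ ε)) :=
        Finset.prod_le_prod (fun _ _ => by positivity)
          fun p hp => key p _ (Nat.prime_of_mem_primeFactors hp)
    _ = (∏ p ∈ n.primeFactors, if p < P then B else 1) * (n : ℝ) ^ ε := by
        rw [Finset.prod_mul_distrib, Real.finsetProd_rpow _ _ (fun _ _ => by positivity),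
          ← Nat.cast_prod]
        congr 3
        exact_mod_cast Nat.prod_factorization_pow_eq_self hn
    _ ≤ B ^ P * (n : ℝ) ^ ε := by
        gcongr
        rw [← Finset.prod_filter, Finset.prod_const]
        refine pow_le_pow_right₀ hB1 ?_
        calc _ ≤ (Finset.range P).card := Finset.card_le_card fun p hp => by
              simpa using (Finset.mem_filter.1 hp).2
          _ = P := Finset.card_range P

/-- The roots of `t ^ 2 - t + 1` modulo `m`, as residues in `[0, m)`. -/
def rootsMod (m : ℕ) : Finset ℕ :=
  (Finset.range m).filter fun t => (m : ℤ) ∣ (t : ℤ) ^ 2 - t + 1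

theorem mem_rootsMod {m t : ℕ} : t ∈ rootsMod m ↔ t < m ∧ (m : ℤ) ∣ (t : ℤ) ^ 2 - t + 1 := by
  simp [rootsMod]

theorem mod_mem_rootsMod {a m t : ℕ} (ha : 0 < a) (ham : a ∣ m) (ht : t ∈ rootsMod m) :
    t % a ∈ rootsMod a := by
  rw [mem_rootsMod] at ht ⊢
  refine ⟨Nat.mod_lt _ ha, ?_⟩
  have h : ((t % a : ℕ) : ℤ) ≡ t [ZMOD a] := by
    push_cast
    exact Int.mod_modEq _ _
  have h2 := ((h.pow 2).sub h).add_right 1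
  exact (Int.ModEq.dvd_iff h2).2 ((Int.natCast_dvd_natCast.2 ham).trans ht.2)

theorem card_rootsMod_mul_le {a b : ℕ} (ha : 0 < a) (hb : 0 < b) (hab : a.Coprime b) :
    (rootsMod (a * b)).card ≤ (rootsMod a).card * (rootsMod b).card := by
  rw [← Finset.card_product]
  refine Finset.card_le_card_of_injOn (fun t => (t % a, t % b)) ?_ ?_
  · intro t ht
    exact Finset.mem_coe.2 (Finset.mem_product.2
      ⟨mod_mem_rootsMod ha (dvd_mul_right a b) ht, mod_mem_rootsMod hb (dvd_mul_left b a) ht⟩)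
  · intro s hs t ht hst
    obtain ⟨h1, h2⟩ := Prod.mk.inj hst
    exact ((Nat.modEq_and_modEq_iff_modEq_mul hab).1 ⟨h1, h2⟩).eq_of_lt_of_lt
      (mem_rootsMod.1 hs).1 (mem_rootsMod.1 ht).1

theorem card_rootsMod_prime_pow_le {p : ℕ} (hp : p.Prime) (a : ℕ) :
    (rootsMod (p ^ a)).card ≤ 3 := by
  by_cases hp3 : p = 3
  · subst hp3
    match a with
    | 0 => exact (Finset.card_filter_le _ _).trans (by simp)
    | 1 => exact (Finset.card_filter_le _ _).trans (by simp)
    | a + 2 =>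
      suffices rootsMod (3 ^ (a + 2)) = ∅ by simp [this]
      refine Finset.eq_empty_of_forall_notMem fun t ht => ?_
      have h := mod_mem_rootsMod (a := 9) (by norm_num) ⟨3 ^ a, by ring⟩ ht
      have h9 : rootsMod 9 = ∅ := by decide
      simp [h9] at h
  · by_contra! hcard
    obtain ⟨r, hr, s, hs, t, ht, hrs, hrt, hst⟩ := Finset.two_lt_card.1 (Nat.lt_of_succ_lt hcard)
    have hpZ : Prime (p : ℤ) := Nat.prime_iff_prime_int.1 hp
    have reflect : ∀ x y : ℕ, x ∈ rootsMod (p ^ a) → y ∈ rootsMod (p ^ a) → x ≠ y →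
        (p : ℤ) ^ a ∣ x + y - 1 := by
      intro x y hx hy hxy
      rw [mem_rootsMod] at hx hy
      obtain ⟨hxl, hx⟩ := hx
      obtain ⟨hyl, hy⟩ := hy
      have ha : a ≠ 0 := by
        rintro rfl
        simp only [pow_zero] at hxl hyl
        lia
      push_cast at hx hy
      have hmul : (p : ℤ) ^ a ∣ (x - y) * (x + y - 1) := by
        have := dvd_sub hx hy
        rwa [show (x : ℤ) ^ 2 - x + 1 - (y ^ 2 - y + 1) = (x - y) * (x + y - 1) by ring] at this
      by_cases hd : (p : ℤ) ∣ x - y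
      · refine absurd (Nat.ModEq.eq_of_lt_of_lt ?_ hxl hyl) hxy
        rw [Nat.ModEq.comm, Nat.modEq_iff_dvd]
        push_cast
        refine hpZ.pow_dvd_of_dvd_mul_right a (fun hd2 => hp3 ?_) hmul
        have h2 : (p : ℤ) ∣ 2 * x - 1 := by
          have := dvd_add hd hd2
          rwa [show (x : ℤ) - y + (x + y - 1) = 2 * x - 1 by ring] at this
        have h3 : (p : ℤ) ∣ 3 := by
          have h4 := dvd_sub (((dvd_pow_self _ ha).trans hx).mul_left 4) (h2.mul_left (2 * x - 1))
          rwa [show 4 * ((x : ℤ) ^ 2 - x + 1) - (2 * x - 1) * (2 * x - 1) = 3 by ring] at h4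
        exact (Nat.prime_dvd_prime_iff_eq hp Nat.prime_three).1 (by exact_mod_cast h3)
      · exact hpZ.pow_dvd_of_dvd_mul_left a hd hmul
    refine hst (Nat.ModEq.eq_of_lt_of_lt ?_ (mem_rootsMod.1 hs).1 (mem_rootsMod.1 ht).1)
    rw [Nat.ModEq.comm, Nat.modEq_iff_dvd]
    push_cast
    have := dvd_sub (reflect r s hr hs hrs) (reflect r t hr ht hrt)
    rwa [show (r : ℤ) + s - 1 - (r + t - 1) = s - t by ring] at this

theorem card_rootsMod_le (m : ℕ) : (rootsMod m).card ≤ m.divisors.card ^ 2 := by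
  induction m using Nat.recOnPosPrimePosCoprime with
  | prime_pow p a hp ha =>
    refine (card_rootsMod_prime_pow_le hp a).trans ?_
    rw [Nat.divisors_prime_pow hp, Finset.card_map, Finset.card_range]
    nlinarith
  | zero => simp [rootsMod]
  | one => exact (Finset.card_filter_le _ _).trans (by simp)
  | coprime a b ha hb hab iha ihb =>
    refine (card_rootsMod_mul_le (by lia) (by lia) hab).trans ?_
    rw [hab.card_divisors_mul, mul_pow]
    exact Nat.mul_le_mul iha ihb

/-- The representations of `k` by the norm form of the Eisenstein integers. -/
noncomputable def eisensteinReps (k : ℕ) : Finset (ℤ × ℤ) :=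
  (Finset.Icc (-(2 * k : ℤ)) (2 * k) ×ˢ Finset.Icc (-(2 * k : ℤ)) (2 * k)).filter
    fun z => z.1 ^ 2 - z.1 * z.2 + z.2 ^ 2 = k

theorem mem_eisensteinReps {k : ℕ} {z : ℤ × ℤ} :
    z ∈ eisensteinReps k ↔ z.1 ^ 2 - z.1 * z.2 + z.2 ^ 2 = k := by
  have bound : ∀ u v : ℤ, u ^ 2 - u * v + v ^ 2 = k → -(2 * k : ℤ) ≤ u ∧ u ≤ 2 * k := by
    intro u v h
    have h1 : 3 * u ^ 2 ≤ 4 * k := by nlinarith [sq_nonneg (2 * v - u)]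
    have h2 := Int.le_self_sq u
    have h3 := Int.le_self_sq (-u)
    rw [neg_sq] at h3
    constructor <;> lia
  simp only [eisensteinReps, Finset.mem_filter, Finset.mem_product, Finset.mem_Icc,
    and_iff_right_iff_imp]
  exact fun h => ⟨bound _ _ h, bound z.2 z.1 (by linarith)⟩

/-- The quotient of any two elements of `s`, viewed as Eisenstein integers of norm `k`, is one of
the six units: the divisibility forces `z * conj w` to be `k` times a unit. -/
theorem card_le_six_of_dvd_det {k : ℕ} (hk : k ≠ 0) {s : Finset (ℤ × ℤ)}
    (hs : s ⊆ eisensteinReps k)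
    (hdet : ∀ z ∈ s, ∀ w ∈ s, (k : ℤ) ∣ z.2 * w.1 - z.1 * w.2) : s.card ≤ 6 := by
  obtain rfl | ⟨w, hw⟩ := s.eq_empty_or_nonempty
  · simp
  have hkZ : (0 : ℤ) < k := by exact_mod_cast Nat.pos_of_ne_zero hk
  have hwk := mem_eisensteinReps.1 (hs hw)
  let units : Finset (ℤ × ℤ) := {(1, 0), (-1, 0), (0, 1), (0, -1), (1, 1), (-1, -1)}
  refine (Finset.card_le_card_of_injOn (t := units.image fun e => ((k : ℤ) * e.1, (k : ℤ) * e.2))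
    (fun z => (z.1 * w.1 - z.1 * w.2 + z.2 * w.2, z.2 * w.1 - z.1 * w.2)) ?_ ?_).trans
    (Finset.card_image_le.trans (by decide))
  · intro z hz
    have hzk := mem_eisensteinReps.1 (hs hz)
    obtain ⟨d, hd⟩ := hdet z hz w hw
    set A := z.1 * w.1 - z.1 * w.2 + z.2 * w.2 with hA
    have hnorm : A ^ 2 - A * (k * d) + (k * d) ^ 2 = k ^ 2 := by
      rw [← hd, hA]
      calc _ = (z.1 ^ 2 - z.1 * z.2 + z.2 ^ 2) * (w.1 ^ 2 - w.1 * w.2 + w.2 ^ 2) := by ring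
        _ = _ := by rw [hzk, hwk]; ring
    have hd1 : 3 * d ^ 2 ≤ 4 := by
      have : (3 * d ^ 2) * (k : ℤ) ^ 2 ≤ 4 * (k : ℤ) ^ 2 := by
        nlinarith [sq_nonneg (2 * A - k * d)]
      exact le_of_mul_le_mul_right this (by positivity)
    have hdl : -1 ≤ d := by nlinarith
    have hdu : d ≤ 1 := by nlinarith
    simp only [Finset.mem_coe, Finset.mem_image, units]
    simp only [hd]
    obtain rfl | rfl | rfl : d = -1 ∨ d = 0 ∨ d = 1 := by lia
    · have : A * (A + k) = 0 := by linarith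
      rcases mul_eq_zero.1 this with h | h
      · exact ⟨(0, -1), by simp, by ext <;> simp; lia⟩
      · exact ⟨(-1, -1), by simp, by ext <;> simp; lia⟩
    · have : (A - k) * (A + k) = 0 := by linarith
      rcases mul_eq_zero.1 this with h | h
      · exact ⟨(1, 0), by simp, by ext <;> simp; lia⟩
      · exact ⟨(-1, 0), by simp, by ext <;> simp; lia⟩
    · have : A * (A - k) = 0 := by linarith
      rcases mul_eq_zero.1 this with h | h
      · exact ⟨(0, 1), by simp, by ext <;> simp; lia⟩
      · exact ⟨(1, 1), by simp, by ext <;> simp; lia⟩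
  · intro x _ y _ hxy
    obtain ⟨h1, h2⟩ := Prod.mk.inj hxy
    have e1 : (k : ℤ) * x.1 = k * y.1 := by
      rw [← hwk]; linear_combination w.1 * h1 - w.2 * h2
    have e2 : (k : ℤ) * x.2 = k * y.2 := by
      rw [← hwk]; linear_combination w.2 * h1 + (w.1 - w.2) * h2
    exact Prod.ext (mul_left_cancel₀ hkZ.ne' e1) (mul_left_cancel₀ hkZ.ne' e2)

theorem exists_mem_rootsMod {u v : ℤ} (huv : IsCoprime u v) {m : ℕ} (hm : m ≠ 0)
    (h : u ^ 2 - u * v + v ^ 2 = m) : ∃ t ∈ rootsMod m, (m : ℤ) ∣ u - t * v := by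
  have hvm : IsCoprime v (m : ℤ) := by
    rw [← h, show u ^ 2 - u * v + v ^ 2 = u ^ 2 + v * (v - u) by ring]
    exact huv.symm.pow_right.add_mul_left_right _
  obtain ⟨a, b, hab⟩ := hvm
  have hmZ : (0 : ℤ) < m := by exact_mod_cast Nat.pos_of_ne_zero hm
  obtain ⟨t, ht⟩ := Int.eq_ofNat_of_zero_le (Int.emod_nonneg (u * a) hmZ.ne')
  have htm : (m : ℤ) ∣ u - t * v := by
    have h1 : (m : ℤ) ∣ u * a - t := by
      rw [← ht]; exact Int.dvd_self_sub_emod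
    obtain ⟨c, hc⟩ := h1
    exact ⟨u * b + c * v, by linear_combination v * hc - u * hab⟩
  refine ⟨t, mem_rootsMod.2 ⟨?_, ?_⟩, htm⟩
  · have := Int.emod_lt_of_pos (u * a) hmZ
    rw [ht] at this
    exact_mod_cast this
  · have hcop : IsCoprime (m : ℤ) (v ^ 2) := IsCoprime.pow_right ⟨b, a, by linarith⟩
    refine hcop.dvd_of_dvd_mul_left ?_
    obtain ⟨c, hc⟩ := htm
    exact ⟨1 - c * (u + t * v - v), by linear_combination h - (u + t * v - v) * hc⟩

theorem card_eisensteinReps_le {k : ℕ} (hk : k ≠ 0) :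
    (eisensteinReps k).card ≤ 6 * k.divisors.card ^ 3 := by
  classical
  have hcover : eisensteinReps k ⊆ (k.divisors.filter fun g => g ^ 2 ∣ k).biUnion fun g =>
      (rootsMod (k / g ^ 2)).biUnion fun t => (eisensteinReps k).filter fun z =>
        (g : ℤ) ∣ z.2 ∧ ((g * (k / g ^ 2) : ℕ) : ℤ) ∣ z.1 - t * z.2 := by
    intro z hz
    have hzk := mem_eisensteinReps.1 hz
    have hg : 0 < Int.gcd z.1 z.2 := by
      rw [Int.gcd_pos_iff]
      by_contra! h0
      rw [h0.1, h0.2] at hzk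
      norm_num at hzk
      lia
    obtain ⟨u, v, huv, hu, hv⟩ := Int.exists_gcd_one hg
    set g := Int.gcd z.1 z.2
    have hgZ : (0 : ℤ) < g := by exact_mod_cast hg
    have hkg : (k : ℤ) = (g : ℤ) ^ 2 * (u ^ 2 - u * v + v ^ 2) := by
      rw [← hzk, hu, hv]; ring
    have hdvd : g ^ 2 ∣ k := by
      have : ((g ^ 2 : ℕ) : ℤ) ∣ k := by push_cast; exact ⟨_, hkg⟩
      exact_mod_cast this
    obtain ⟨m, hm⟩ := hdvd
    have hdiv : k / g ^ 2 = m := by rw [hm, Nat.mul_div_cancel_left _ (by positivity)]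
    have hm0 : m ≠ 0 := by rintro rfl; simp at hm; exact hk hm
    have hmuv : u ^ 2 - u * v + v ^ 2 = m := by
      rw [hm] at hkg
      push_cast at hkg
      exact (mul_left_cancel₀ (by positivity) hkg).symm
    obtain ⟨t, ht, htd⟩ := exists_mem_rootsMod (Int.isCoprime_iff_gcd_eq_one.2 huv) hm0 hmuv
    simp only [Finset.mem_biUnion, Finset.mem_filter, Nat.mem_divisors]
    refine ⟨g, ⟨⟨⟨g * m, by rw [hm]; ring⟩, hk⟩, m, hm⟩, t, hdiv ▸ ht, hz,
      ⟨v, by rw [hv]; ring⟩, ?_⟩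
    rw [hdiv]
    push_cast
    obtain ⟨c, hc⟩ := htd
    exact ⟨c, by rw [hu, hv]; linear_combination (g : ℤ) * hc⟩
  refine (Finset.card_le_card hcover).trans ?_
  have hfiber : ∀ g ∈ k.divisors.filter (fun g => g ^ 2 ∣ k), ((rootsMod (k / g ^ 2)).biUnion fun t =>
      (eisensteinReps k).filter fun z =>
        (g : ℤ) ∣ z.2 ∧ ((g * (k / g ^ 2) : ℕ) : ℤ) ∣ z.1 - t * z.2).card
      ≤ k.divisors.card ^ 2 * 6 := by
    intro g hg
    have hgk := (Finset.mem_filter.1 hg).2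
    refine (Finset.card_biUnion_le_card_mul _ _ 6 fun t _ => ?_).trans ?_
    · refine card_le_six_of_dvd_det hk (Finset.filter_subset _ _) fun z hz w hw => ?_
      obtain ⟨_, ⟨a, ha⟩, b, hb⟩ := Finset.mem_filter.1 hz
      obtain ⟨_, ⟨c, hc⟩, d, hd⟩ := Finset.mem_filter.1 hw
      have hk2 : (k : ℤ) = g ^ 2 * (k / g ^ 2 : ℕ) := by
        exact_mod_cast (Nat.mul_div_cancel' hgk).symm
      generalize k / g ^ 2 = m at *
      push_cast at hb hd
      refine ⟨a * d - b * c, ?_⟩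
      rw [hk2]
      linear_combination (z.2 : ℤ) * hd - w.2 * hb + g * m * d * ha - g * m * b * hc
    · gcongr
      refine (card_rootsMod_le _).trans (Nat.pow_le_pow_left ?_ 2)
      exact Finset.card_le_card (Nat.divisors_subset_of_dvd hk (Nat.div_dvd_of_dvd hgk))
  calc _ ≤ _ := Finset.card_biUnion_le_card_mul _ _ _ hfiber
    _ ≤ k.divisors.card * (k.divisors.card ^ 2 * 6) := by
      gcongr
      exact Finset.filter_subset _ _
    _ = _ := by ring

theorem exists_card_eisensteinReps_mul_rpow_le {σ : ℝ} (hσ : 0 < σ) :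
    ∃ C : ℝ, 0 < C ∧ ∀ k : ℕ,
      ((eisensteinReps k).card : ℝ) * (1 + 2 * (k : ℝ) / 3) ^ (-σ) ≤ C := by
  obtain ⟨D, hD, hdiv⟩ := exists_card_divisors_le_rpow (ε := σ / 3) (by positivity)
  refine ⟨max 1 (6 * D ^ 3 * (3 / 2) ^ σ), by positivity, fun k => ?_⟩
  obtain rfl | hk := eq_or_ne k 0
  · have h : (eisensteinReps 0).card ≤ 1 := (Finset.card_filter_le _ _).trans (by simp)
    refine le_max_of_le_left ?_
    simpa using h
  refine le_max_of_le_right ?_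
  have hpos : (0 : ℝ) < 1 + 2 * (k : ℝ) / 3 := by positivity
  rw [Real.rpow_neg hpos.le, ← div_eq_mul_inv, div_le_iff₀ (by positivity)]
  calc ((eisensteinReps k).card : ℝ) ≤ 6 * (k.divisors.card : ℝ) ^ 3 := by
        exact_mod_cast card_eisensteinReps_le hk
    _ ≤ 6 * (D * (k : ℝ) ^ (σ / 3)) ^ 3 := by
        gcongr
        exact hdiv k hk
    _ = 6 * D ^ 3 * (k : ℝ) ^ σ := by
        rw [mul_pow, ← Real.rpow_mul_natCast (by positivity)]
        norm_num
        ring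
    _ ≤ 6 * D ^ 3 * (3 / 2 * (1 + 2 * (k : ℝ) / 3)) ^ σ := by
        gcongr
        linarith
    _ = _ := by
        rw [Real.mul_rpow (by positivity) hpos.le]
        ring

theorem jb_rpow (x s : ℝ) : jb x ^ s = (1 + x ^ 2) ^ (s / 2) := by
  rw [jb, Real.sqrt_eq_rpow, ← Real.rpow_mul (by positivity)]
  congr 1
  ring

theorem summable_one_add_sq_rpow {b : ℝ} (hb : 1 / 2 < b) :
    Summable fun j : ℤ => (1 + (j : ℝ) ^ 2) ^ (-b) := by
  refine (((Real.summable_one_div_int_add_rpow (1 / 2) (2 * b)).2 (by linarith)).mul_left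
    (2 ^ b)).of_nonneg_of_le (fun _ => by positivity) fun j => ?_
  have hne : (j : ℝ) + 1 / 2 ≠ 0 := by
    intro h
    have : 2 * (j : ℝ) + 1 = 0 := by linarith
    norm_cast at this
    lia
  have hpos : 0 < ((j : ℝ) + 1 / 2) ^ 2 / 2 := by positivity
  calc (1 + (j : ℝ) ^ 2) ^ (-b) ≤ (((j : ℝ) + 1 / 2) ^ 2 / 2) ^ (-b) :=
        Real.rpow_le_rpow_of_nonpos hpos (by nlinarith [sq_nonneg ((j : ℝ) - 1 / 2)])
          (by linarith)
    _ = _ := by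
        rw [Real.rpow_neg hpos.le, Real.div_rpow (by positivity) two_pos.le, inv_div,
          ← sq_abs, ← Real.rpow_natCast, ← Real.rpow_mul (abs_nonneg _)]
        push_cast
        ring

theorem exists_tsum_jb_rpow_le {σ : ℝ} (hσ : 0 < σ) :
    ∃ C : ℝ, 0 < C ∧ ∀ η : ℝ,
      ∑' k : ℕ, ENNReal.ofReal (jb (η + 2 * (k : ℝ) / 3) ^ (-(1 + 2 * σ))) ≤ ENNReal.ofReal C := by
  set b : ℝ := 1 / 2 + σ with hb
  set F : ℤ → ℝ := fun j => 5 ^ b * (1 + (j : ℝ) ^ 2) ^ (-b) with hF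
  have hF0 : ∀ j, 0 ≤ F j := fun j => by positivity
  have hsum : Summable F := (summable_one_add_sq_rpow (by linarith)).mul_left _
  have htsum : 0 ≤ ∑' j, F j := tsum_nonneg hF0
  refine ⟨∑' j, F j + 1, by linarith, fun η => ?_⟩
  set j₀ : ℤ := ⌊-(3 * η / 2)⌋ with hj
  calc ∑' k : ℕ, ENNReal.ofReal (jb (η + 2 * (k : ℝ) / 3) ^ (-(1 + 2 * σ)))
      ≤ ∑' k : ℕ, ENNReal.ofReal (F ((k : ℤ) - j₀)) := by
        refine ENNReal.tsum_le_tsum fun k => ENNReal.ofReal_le_ofReal ?_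
        have h1 := Int.floor_le (-(3 * η / 2))
        have h2 := Int.lt_floor_add_one (-(3 * η / 2))
        rw [← hj] at h1 h2
        have hpos : (0 : ℝ) < 1 + (((k : ℤ) - j₀ : ℤ) : ℝ) ^ 2 := by positivity
        rw [jb_rpow, show -(1 + 2 * σ) / 2 = -b by rw [hb]; ring]
        calc _ ≤ ((1 + (((k : ℤ) - j₀ : ℤ) : ℝ) ^ 2) / 5) ^ (-b) := by
              refine Real.rpow_le_rpow_of_nonpos (by positivity) ?_ (by linarith)
              push_cast
              set δ : ℝ := -(3 * η / 2) - j₀ with hδ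
              rw [show η = -(2 / 3) * (δ + j₀) by rw [hδ]; ring]
              have hδ0 : 0 ≤ δ := by linarith
              have hδ1 : δ ≤ 1 := by linarith
              nlinarith [sq_nonneg ((k : ℝ) - j₀ - 2 * δ)]
          _ = F ((k : ℤ) - j₀) := by
              rw [Real.div_rpow hpos.le (by norm_num), Real.rpow_neg (by norm_num : (0 : ℝ) ≤ 5),
                div_inv_eq_mul, mul_comm]
    _ ≤ ∑' j : ℤ, ENNReal.ofReal (F j) :=
        ENNReal.tsum_comp_le_tsum_of_injective (f := fun k : ℕ => (k : ℤ) - j₀)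
          (fun x y h => by simpa using h) _
    _ = ENNReal.ofReal (∑' j, F j) := (ENNReal.ofReal_tsum_of_nonneg hF0 hsum).symm
    _ ≤ _ := ENNReal.ofReal_le_ofReal (by linarith)

theorem jb_rpow_mul_three_le {σ : ℝ} (hσ : 0 < σ) {x y z q : ℝ} (hq : 0 ≤ q)
    (h : q ≤ x ^ 2 + y ^ 2 + z ^ 2) :
    jb x ^ (-(2 * σ)) * jb y ^ (-(2 * σ)) * jb z ^ (-(2 * σ)) ≤ (1 + q) ^ (-σ) := by
  simp only [jb_rpow, show -(2 * σ) / 2 = -σ by ring]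
  rw [← Real.mul_rpow (by positivity) (by positivity),
    ← Real.mul_rpow (by positivity) (by positivity)]
  refine Real.rpow_le_rpow_of_nonpos (by positivity) ?_ (by linarith)
  have h1 : 0 ≤ x ^ 2 * y ^ 2 := by positivity
  have h2 : 0 ≤ (x ^ 2 + y ^ 2 + x ^ 2 * y ^ 2) * z ^ 2 := by positivity
  nlinarith

/-- A sum over pairs grouped according to the value of the Eisenstein norm form. -/
theorem tsum_ite_mem_eisensteinReps {φ : ℤ × ℤ → ℤ × ℤ} (hφ : φ.Injective) (G : ℕ → ℝ≥0∞) :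
    ∑' m, ∑' k, (if φ m ∈ eisensteinReps k then G k else 0)
      ≤ ∑' k, ((eisensteinReps k).card : ℝ≥0∞) * G k := by
  rw [ENNReal.tsum_comm]
  refine ENNReal.tsum_le_tsum fun k => ?_
  refine (ENNReal.tsum_comp_le_tsum_of_injective hφ
    fun z => if z ∈ eisensteinReps k then G k else 0).trans (le_of_eq ?_)
  rw [tsum_eq_sum (s := eisensteinReps k) fun z hz => if_neg hz,
    Finset.sum_congr rfl fun z hz => if_pos hz, Finset.sum_const, nsmul_eq_mul]

/-- Uniform counting bound behind the periodic `L⁶` Strichartz estimate: for every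
`σ > 0` there is `C > 0` with
`∑_{n₁,n₂} ⟨n₁⟩^{−2σ} ⟨n₂⟩^{−2σ} ⟨n−n₁−n₂⟩^{−2σ} ⟨ξ+n₁²+n₂²+(n−n₁−n₂)²⟩^{−1−2σ} ≤ C`
for all `n ∈ ℤ`, `ξ ∈ ℝ`. -/
theorem resonance_weight_sum_bound (σ : ℝ) (hσ : 0 < σ) :
    ∃ C : ℝ, 0 < C ∧ ∀ (n : ℤ) (ξ : ℝ),
      (∑' m : ℤ × ℤ, ENNReal.ofReal
          (jb (m.1 : ℝ) ^ (-(2 * σ)) * jb (m.2 : ℝ) ^ (-(2 * σ)) *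
            jb ((n : ℝ) - (m.1 : ℝ) - (m.2 : ℝ)) ^ (-(2 * σ)) *
            jb (ξ + (m.1 : ℝ) ^ 2 + (m.2 : ℝ) ^ 2 +
                ((n : ℝ) - (m.1 : ℝ) - (m.2 : ℝ)) ^ 2) ^ (-(1 + 2 * σ))))
        ≤ ENNReal.ofReal C := by
  obtain ⟨A, hA, hcard⟩ := exists_card_eisensteinReps_mul_rpow_le hσ
  obtain ⟨B, hB, hsum⟩ := exists_tsum_jb_rpow_le hσ
  refine ⟨A * B, mul_pos hA hB, fun n ξ => ?_⟩
  have hjb : ∀ x s : ℝ, 0 ≤ jb x ^ s := fun x s => Real.rpow_nonneg (Real.sqrt_nonneg _) _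
  let φ : ℤ × ℤ → ℤ × ℤ := fun m => (2 * m.1 + m.2 - n, m.1 + 2 * m.2 - n)
  have hφ : φ.Injective := by
    intro x y h
    obtain ⟨h1, h2⟩ := Prod.mk.inj h
    ext <;> lia
  let η : ℝ := ξ + (n : ℝ) ^ 2 / 3
  let G : ℕ → ℝ := fun k =>
    (1 + 2 * (k : ℝ) / 3) ^ (-σ) * jb (η + 2 * (k : ℝ) / 3) ^ (-(1 + 2 * σ))
  calc _ ≤ ∑' m, ∑' k, (if φ m ∈ eisensteinReps k then ENNReal.ofReal (G k) else 0) := by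
        refine ENNReal.tsum_le_tsum fun m => ?_
        obtain ⟨k, hk⟩ := Int.eq_ofNat_of_zero_le
          (show 0 ≤ (φ m).1 ^ 2 - (φ m).1 * (φ m).2 + (φ m).2 ^ 2 by
            nlinarith [sq_nonneg ((φ m).1 - (φ m).2), sq_nonneg (φ m).1, sq_nonneg (φ m).2])
        refine le_trans ?_ (ENNReal.le_tsum k)
        rw [if_pos (mem_eisensteinReps.2 hk)]
        have hkR : (m.1 : ℝ) ^ 2 + (m.2 : ℝ) ^ 2 + ((n : ℝ) - m.1 - m.2) ^ 2
            = (n : ℝ) ^ 2 / 3 + 2 * (k : ℝ) / 3 := by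
          have h : (2 * m.1 + m.2 - n : ℝ) ^ 2 - (2 * m.1 + m.2 - n) * (m.1 + 2 * m.2 - n)
              + (m.1 + 2 * m.2 - n) ^ 2 = k := by exact_mod_cast hk
          linear_combination (2 / 3 : ℝ) * h
        refine ENNReal.ofReal_le_ofReal (mul_le_mul ?_ (le_of_eq ?_) (hjb _ _) (by positivity))
        · refine jb_rpow_mul_three_le hσ (by positivity) ?_
          rw [hkR]
          linarith [sq_nonneg (n : ℝ)]
        · congr 2
          simp only [η]
          linear_combination hkR
    _ ≤ ∑' k, ((eisensteinReps k).card : ℝ≥0∞) * ENNReal.ofReal (G k) :=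
        tsum_ite_mem_eisensteinReps hφ _
    _ ≤ ∑' k : ℕ, ENNReal.ofReal A *
          ENNReal.ofReal (jb (η + 2 * (k : ℝ) / 3) ^ (-(1 + 2 * σ))) := by
        refine ENNReal.tsum_le_tsum fun k => ?_
        rw [← ENNReal.ofReal_natCast, ← ENNReal.ofReal_mul (by positivity),
          ← ENNReal.ofReal_mul hA.le, ← mul_assoc]
        exact ENNReal.ofReal_le_ofReal (mul_le_mul_of_nonneg_right (hcard k) (hjb _ _))
    _ ≤ ENNReal.ofReal (A * B) := by
        rw [ENNReal.tsum_mul_left, ENNReal.ofReal_mul hA.le]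
        gcongr
        exact hsum η
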